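/- Let U be a finite nonempty set, let γ, α ∈ (0,1] and β ∈ (0,1), and let m, t ∈ ℕ with t ≥ (24/(α²γ²))·ln(4m/β). For each j ∈ [m], let S_j ⊆ U be a subset with |S_j| ≥ (γ/(1+γ))·|U|, and let f_j : U → {0,1} be a predicate whose average over S_j satisfies f_j(S_j) ≥ γ/(1+γ). Let D = (D_1, …, D_t) be i.i.d. uniform samples from U, and for each j let T_j be the multiset of those samples D_i that lie in S_j. Then with probability at least 1 − β, simultaneously for every j ∈ [m]: T_j is nonempty and |f_j(T_j) − f_j(S_j)| ≤ α·f_j(S_j), i.e. f_j(T_j) ∈ (1 ± α)·f_j(S_j). -/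

import Mathlib

open MeasureTheory

/-- Exponential-moment bound: the tilted weight of `x ∈ S`, with weight `1` off `S`, averages to at
most `exp (-(3/16) α² c²)` when both the density of `S` and the average `p` of the
`{0,1}`-valued `f` on `S` are at least `c`. -/
theorem sum_tilted_le {U : Type*} [Fintype U] [Nonempty U] [DecidableEq U]
    {c α σ p : ℝ} (hc : 0 < c) (hα0 : 0 < α) (hα1 : α ≤ 1) (hσ : σ ^ 2 = α ^ 2 / 4)
    {S : Finset U} (hS : c * (Fintype.card U : ℝ) ≤ (S.card : ℝ))
    {f : U → ℝ} (hf : ∀ x, f x = 0 ∨ f x = 1)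
    (hp : p = (∑ x ∈ S, f x) / (S.card : ℝ)) (hcp : c ≤ p) :
    ∑ x, (if x ∈ S then Real.exp (σ * (f x - p) - α ^ 2 / 2 * p) else 1) ≤
      Fintype.card U * Real.exp (-(3 / 16 * α ^ 2 * c ^ 2)) := by
  have hN : (0 : ℝ) < Fintype.card U := by exact_mod_cast Fintype.card_pos
  have hS0 : (0 : ℝ) < S.card := lt_of_lt_of_le (by positivity) hS
  have hsum : ∑ x ∈ S, f x = p * S.card := by rw [hp]; field_simp
  have hp1 : p ≤ 1 := by
    rw [hp, div_le_one hS0]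
    calc ∑ x ∈ S, f x ≤ ∑ x ∈ S, (1 : ℝ) :=
          Finset.sum_le_sum fun x _ => by rcases hf x with h | h <;> simp [h]
      _ = S.card := by simp
  have hp0 : 0 < p := hc.trans_le hcp
  have hα2 : α ^ 2 ≤ 1 := by nlinarith
  have hexp : ∀ y : ℝ, |y| ≤ 1 → Real.exp y ≤ 1 + y + y ^ 2 := fun y hy => by
    have := (abs_le.1 (Real.abs_exp_sub_one_sub_id_le hy)).2
    linarith
  have hσ1 : |σ| ≤ 1 := by
    rw [← sq_le_one_iff_abs_le_one]; linarith
  have hx1 : |-(α ^ 2 / 4 * p)| ≤ 1 := by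
    rw [abs_neg, abs_of_pos (by positivity)]; nlinarith
  have hin : ∑ x ∈ S, Real.exp (σ * (f x - p) - α ^ 2 / 2 * p) ≤
      S.card * Real.exp (-(α ^ 2 / 4 * p)) := by
    have h1 : ∀ x ∈ S, Real.exp (σ * (f x - p) - α ^ 2 / 2 * p) =
        (1 + f x * (Real.exp σ - 1)) * Real.exp (-σ * p - α ^ 2 / 2 * p) := fun x _ => by
      have : σ * (f x - p) - α ^ 2 / 2 * p = σ * f x + (-σ * p - α ^ 2 / 2 * p) := by ring
      rw [this, Real.exp_add]
      congr 1
      rcases hf x with h | h <;> simp [h]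
    rw [Finset.sum_congr rfl h1, ← Finset.sum_mul, Finset.sum_add_distrib, ← Finset.sum_mul, hsum]
    have h2 : 1 + p * (Real.exp σ - 1) ≤ Real.exp (p * (σ + σ ^ 2)) := by
      have := Real.add_one_le_exp (p * (σ + σ ^ 2))
      nlinarith [hexp σ hσ1]
    calc _ = (S.card : ℝ) * ((1 + p * (Real.exp σ - 1)) *
              Real.exp (-σ * p - α ^ 2 / 2 * p)) := by
            simp only [Finset.sum_const, nsmul_eq_mul]; ring
      _ ≤ S.card * (Real.exp (p * (σ + σ ^ 2)) * Real.exp (-σ * p - α ^ 2 / 2 * p)) :=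
            mul_le_mul_of_nonneg_left
              (mul_le_mul_of_nonneg_right h2 (Real.exp_pos _).le) hS0.le
      _ = _ := by
            rw [← Real.exp_add, hσ]; ring_nf
  have hdecay : Real.exp (-(α ^ 2 / 4 * p)) ≤ 1 - 3 / 16 * α ^ 2 * c := by
    have h := hexp _ hx1
    have h3 : α ^ 2 / 4 * p ≤ 1 / 4 := by nlinarith
    have h4 : α ^ 2 / 4 * c ≤ α ^ 2 / 4 * p := by gcongr
    nlinarith [mul_nonneg (by positivity : 0 ≤ α ^ 2 / 4 * p) (sub_nonneg.2 h3)]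
  have hout : ∑ x ∈ Finset.univ.filter (fun x => x ∉ S), (1 : ℝ) = Fintype.card U - S.card := by
    have h := Finset.card_compl_add_card S
    have : Finset.univ.filter (fun x => x ∉ S) = Sᶜ := by ext; simp
    rw [this, ← h]
    push_cast
    simp
  rw [Finset.sum_ite, hout, Finset.filter_mem_eq_inter, Finset.univ_inter]
  have h5 := mul_le_mul_of_nonneg_left hdecay hS0.le
  have h6 := mul_le_mul_of_nonneg_left hS (by positivity : 0 ≤ 3 / 16 * α ^ 2 * c)
  have h7 := mul_le_mul_of_nonneg_left (Real.add_one_le_exp (-(3 / 16 * α ^ 2 * c ^ 2))) hN.le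
  linarith

/-- Chernoff bound, in counting form, for one tail of the sub-sample of points landing in `S`. -/
theorem card_tail_le {U : Type*} [Fintype U] [Nonempty U] [DecidableEq U]
    {c α σ p : ℝ} (hc : 0 < c) (hα0 : 0 < α) (hα1 : α ≤ 1) (hσ : σ ^ 2 = α ^ 2 / 4)
    {S : Finset U} (hS : c * (Fintype.card U : ℝ) ≤ (S.card : ℝ))
    {f : U → ℝ} (hf : ∀ x, f x = 0 ∨ f x = 1)
    (hp : p = (∑ x ∈ S, f x) / (S.card : ℝ)) (hcp : c ≤ p) (t : ℕ) :
    ((Finset.univ.filter fun ω : Fin t → U =>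
        0 ≤ ∑ i ∈ Finset.univ.filter (fun i => ω i ∈ S),
          (σ * (f (ω i) - p) - α ^ 2 / 2 * p)).card : ℝ) ≤
      Fintype.card (Fin t → U) * Real.exp (-(t * (3 / 16 * α ^ 2 * c ^ 2))) := by
  set g : U → ℝ := fun x => if x ∈ S then Real.exp (σ * (f x - p) - α ^ 2 / 2 * p) else 1
    with hg
  have hg0 : ∀ x, 0 ≤ g x := fun x => by
    simp only [hg]; split_ifs <;> positivity
  have hprod : ∀ ω : Fin t → U, ∏ i, g (ω i) =
      Real.exp (∑ i ∈ Finset.univ.filter (fun i => ω i ∈ S),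
        (σ * (f (ω i) - p) - α ^ 2 / 2 * p)) := fun ω => by
    rw [Real.exp_sum, Finset.prod_filter]
  calc _ ≤ ∑ ω : Fin t → U, ∏ i, g (ω i) := by
        rw [Finset.card_filter]
        push_cast
        refine Finset.sum_le_sum fun ω _ => ?_
        rw [hprod]
        split_ifs with h
        · exact Real.one_le_exp h
        · positivity
    _ = (∑ x, g x) ^ t := (Fintype.sum_pow g t).symm
    _ ≤ (Fintype.card U * Real.exp (-(3 / 16 * α ^ 2 * c ^ 2))) ^ t :=
        pow_le_pow_left₀ (Finset.sum_nonneg fun x _ => hg0 x)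
          (sum_tilted_le hc hα0 hα1 hσ hS hf hp hcp) t
    _ = _ := by
        rw [mul_pow, ← Real.exp_nat_mul, Fintype.card_fun, Fintype.card_fin]
        push_cast
        ring_nf

/-- If both one-sided tilted sums over a finite set are negative, then the set is nonempty and
the average over it is within a factor `1 ± α` of `p`. -/
theorem abs_average_sub_le {ι : Type*} {T : Finset ι} {h : ι → ℝ} {α p : ℝ} (hα : 0 < α)
    (h₁ : ∑ i ∈ T, (α / 2 * (h i - p) - α ^ 2 / 2 * p) < 0)
    (h₂ : ∑ i ∈ T, (-(α / 2) * (h i - p) - α ^ 2 / 2 * p) < 0) :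
    0 < T.card ∧ |(∑ i ∈ T, h i) / (T.card : ℝ) - p| ≤ α * p := by
  have hT : 0 < T.card := by
    rw [Finset.card_pos]
    by_contra hne
    rw [Finset.not_nonempty_iff_eq_empty] at hne
    simp [hne] at h₁
  refine ⟨hT, ?_⟩
  have hT' : (0 : ℝ) < T.card := by exact_mod_cast hT
  simp only [Finset.sum_sub_distrib, ← Finset.mul_sum, Finset.sum_const, nsmul_eq_mul] at h₁ h₂
  have k₁ : ∑ i ∈ T, h i < (p + α * p) * T.card := by
    by_contra! hk
    nlinarith [mul_le_mul_of_nonneg_left hk hα.le]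
  have k₂ : (p - α * p) * T.card < ∑ i ∈ T, h i := by
    by_contra! hk
    nlinarith [mul_le_mul_of_nonneg_left hk hα.le]
  rw [← div_lt_iff₀ hT'] at k₁
  rw [← lt_div_iff₀ hT'] at k₂
  rw [abs_le]
  constructor <;> linarith

/-- Probabilistic core of the accuracy of `ObliviousSADA2`: with
`t ≥ (24/(α²γ²))·ln(4m/β)` i.i.d. uniform samples `D` from a finite nonempty set `U`, for
sets `S j ⊆ U` of density at least `γ/(1+γ)` and `{0,1}`-valued queries `f j` of average
at least `γ/(1+γ)` on `S j`, with probability at least `1 − β` simultaneously for every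
`j`: the sub-sample `T j` of points of `D` landing in `S j` is nonempty and the empirical
average of `f j` on `T j` is within a multiplicative `(1 ± α)` factor of its average on
`S j`. -/
theorem stmt8 {U : Type*} [Fintype U] [Nonempty U] [DecidableEq U] [MeasurableSpace U]
    (γ α β : ℝ) (hγ : γ ∈ Set.Ioc (0 : ℝ) 1) (hα : α ∈ Set.Ioc (0 : ℝ) 1)
    (hβ : β ∈ Set.Ioo (0 : ℝ) 1)
    (m t : ℕ) (ht : 24 / (α ^ 2 * γ ^ 2) * Real.log (4 * m / β) ≤ t)
    (S : Fin m → Finset U)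
    (hScard : ∀ j, γ / (1 + γ) * (Fintype.card U : ℝ) ≤ ((S j).card : ℝ))
    (f : Fin m → U → ℝ) (hf01 : ∀ j x, f j x = 0 ∨ f j x = 1)
    (hfS : ∀ j, γ / (1 + γ) ≤ (∑ x ∈ S j, f j x) / ((S j).card : ℝ)) :
    ENNReal.ofReal (1 - β) ≤
      (PMF.uniformOfFintype (Fin t → U)).toMeasure
        {ω | ∀ j, 0 < (Finset.univ.filter fun i => ω i ∈ S j).card ∧
          |(∑ i ∈ Finset.univ.filter fun i => ω i ∈ S j, f j (ω i))
              / ((Finset.univ.filter fun i => ω i ∈ S j).card : ℝ)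
            - (∑ x ∈ S j, f j x) / ((S j).card : ℝ)|
          ≤ α * ((∑ x ∈ S j, f j x) / ((S j).card : ℝ))} := by
  classical
  obtain ⟨hγ0, hγ1⟩ := hγ
  obtain ⟨hα0, hα1⟩ := hα
  obtain ⟨hβ0, hβ1⟩ := hβ
  have hc : γ / 2 ≤ γ / (1 + γ) := by gcongr; linarith
  set p : Fin m → ℝ := fun j => (∑ x ∈ S j, f j x) / ((S j).card : ℝ) with hp
  let tail : ℝ → Fin m → Finset (Fin t → U) := fun σ j => Finset.univ.filter fun ω =>
    0 ≤ ∑ i ∈ Finset.univ.filter (fun i => ω i ∈ S j), (σ * (f j (ω i) - p j) - α ^ 2 / 2 * p j)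
  set N : ℝ := ((Fintype.card (Fin t → U) : ℕ) : ℝ) with hN
  have hN0 : 0 < N := by rw [hN]; exact_mod_cast Fintype.card_pos
  have htail : ∀ σ : ℝ, σ ^ 2 = α ^ 2 / 4 → ∀ j, ((tail σ j).card : ℝ) ≤ N * (β / (4 * m)) := by
    intro σ hσ j
    have hm : (1 : ℝ) ≤ m := by exact_mod_cast j.pos
    refine (card_tail_le (half_pos hγ0) hα0 hα1 hσ
      (le_trans (by gcongr) (hScard j)) (hf01 j) rfl (hc.trans (hfS j)) t).trans ?_
    have hlog : 0 ≤ Real.log (4 * m / β) :=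
      Real.log_nonneg (by rw [le_div_iff₀ hβ0]; linarith)
    have hexp : β / (4 * m) = Real.exp (-Real.log (4 * m / β)) := by
      rw [← Real.log_inv, Real.exp_log (by positivity), inv_div]
    rw [hexp]
    gcongr
    have h := mul_le_mul_of_nonneg_right ht
      (by positivity : 0 ≤ 3 / 16 * α ^ 2 * (γ / 2) ^ 2)
    have h' : 24 / (α ^ 2 * γ ^ 2) * Real.log (4 * m / β) * (3 / 16 * α ^ 2 * (γ / 2) ^ 2) =
        9 / 8 * Real.log (4 * m / β) := by
      field_simp
      ring
    linarith
  set good : Set (Fin t → U) := {ω | ∀ j, 0 < (Finset.univ.filter fun i => ω i ∈ S j).card ∧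
    |(∑ i ∈ Finset.univ.filter fun i => ω i ∈ S j, f j (ω i))
        / ((Finset.univ.filter fun i => ω i ∈ S j).card : ℝ) - p j| ≤ α * p j} with hgood
  set bad : Finset (Fin t → U) :=
    Finset.univ.biUnion fun j => tail (α / 2) j ∪ tail (-(α / 2)) j with hbad
  have hbad_card : (bad.card : ℝ) ≤ β * N := by
    calc (bad.card : ℝ) ≤ ∑ j, ((tail (α / 2) j ∪ tail (-(α / 2)) j).card : ℝ) := by
          exact_mod_cast Finset.card_biUnion_le
      _ ≤ ∑ j : Fin m, (N * (β / (4 * m)) + N * (β / (4 * m))) := by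
          refine Finset.sum_le_sum fun j _ => ?_
          refine le_trans (by exact_mod_cast Finset.card_union_le _ _)
            (add_le_add (htail (α / 2) (by ring) j) (htail (-(α / 2)) (by ring) j))
      _ ≤ β * N := by
          rw [Finset.sum_const, Finset.card_univ, Fintype.card_fin, nsmul_eq_mul]
          rcases Nat.eq_zero_or_pos m with rfl | hm
          · simp; positivity
          · have hm' : (0 : ℝ) < m := by exact_mod_cast hm
            have : (m : ℝ) * (N * (β / (4 * m)) + N * (β / (4 * m))) = β * N / 2 := by
              field_simp
              norm_num
            rw [this]
            linarith [mul_pos hβ0 hN0]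
  have hsub : ((badᶜ : Finset (Fin t → U)) : Set (Fin t → U)) ⊆ good := by
    intro ω hω j
    simp only [hbad, tail, Finset.coe_compl, Set.mem_compl_iff, Finset.mem_coe,
      Finset.mem_biUnion, Finset.mem_union, Finset.mem_filter, Finset.mem_univ, true_and,
      not_exists, not_or, not_le] at hω
    exact abs_average_sub_le hα0 (hω j).1 (hω j).2
  calc ENNReal.ofReal (1 - β)
      ≤ ENNReal.ofReal (((badᶜ : Finset (Fin t → U)).card : ℝ) / N) := by
        apply ENNReal.ofReal_le_ofReal
        rw [le_div_iff₀ hN0, Finset.card_compl, Nat.cast_sub (Finset.card_le_univ _)]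
        linarith
    _ = (PMF.uniformOfFintype (Fin t → U)).toOuterMeasure (badᶜ : Finset (Fin t → U)) := by
        rw [PMF.toOuterMeasure_uniformOfFintype_apply, ENNReal.ofReal_div_of_pos hN0, hN,
          ENNReal.ofReal_natCast, ENNReal.ofReal_natCast]
        simp only [Finset.coe_sort_coe, Fintype.card_coe]
    _ ≤ (PMF.uniformOfFintype (Fin t → U)).toOuterMeasure good :=
        measure_mono hsub
    _ ≤ _ := PMF.toOuterMeasure_apply_le_toMeasure_apply _ _
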